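/- Every Ps-Tychonoff, Fréchet, Lindelöf topological space is Ps-normal. -/

import Mathlib

open Set Topology Filter

universe u v

/-- A subset `K` of a topological space is pseudocompact if every continuous
real-valued function on `K` (with the subspace topology) is bounded. -/
def IsPseudocompactSet {X : Type u} [TopologicalSpace X] (K : Set X) : Prop :=
  ∀ f : K → ℝ, Continuous f → ∃ M : ℝ, ∀ x : K, |f x| ≤ M

/-- A subset `K` is countably compact if every countable open cover of `K`
has a finite subcover. -/
def IsCountablyCompactSet {X : Type u} [TopologicalSpace X] (K : Set X) : Prop :=
  ∀ U : ℕ → Set X, (∀ n, IsOpen (U n)) → K ⊆ ⋃ n, U n →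
    ∃ t : Finset ℕ, K ⊆ ⋃ n ∈ t, U n

/-- `f` restricts to a homeomorphism of `K` onto `f '' K`
(both with their subspace topologies). -/
def RestrictsToHomeo {X : Type u} {Y : Type v} [TopologicalSpace X] [TopologicalSpace Y]
    (f : X → Y) (K : Set X) : Prop :=
  ∃ e : K ≃ₜ (f '' K), ∀ x : K, (e x : Y) = f x

/-- `X` is Ps-normal. -/
def PsNormal (X : Type u) [TopologicalSpace X] : Prop :=
  ∃ (Y : Type u) (_ : TopologicalSpace Y) (f : X → Y), NormalSpace Y ∧
    Function.Bijective f ∧ ∀ K : Set X, IsPseudocompactSet K → RestrictsToHomeo f K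

/-- `X` is CC-normal. -/
def CCNormal (X : Type u) [TopologicalSpace X] : Prop :=
  ∃ (Y : Type u) (_ : TopologicalSpace Y) (f : X → Y), NormalSpace Y ∧
    Function.Bijective f ∧ ∀ K : Set X, IsCountablyCompactSet K → RestrictsToHomeo f K

/-- `X` is C-normal. -/
def CNormal (X : Type u) [TopologicalSpace X] : Prop :=
  ∃ (Y : Type u) (_ : TopologicalSpace Y) (f : X → Y), NormalSpace Y ∧
    Function.Bijective f ∧ ∀ K : Set X, IsCompact K → RestrictsToHomeo f K

/-- `X` is Ps-Tychonoff. -/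
def PsTychonoff (X : Type u) [TopologicalSpace X] : Prop :=
  ∃ (Y : Type u) (_ : TopologicalSpace Y) (f : X → Y), T35Space Y ∧
    Function.Bijective f ∧ ∀ K : Set X, IsPseudocompactSet K → RestrictsToHomeo f K

/-- `X` is C-Tychonoff. -/
def CTychonoff (X : Type u) [TopologicalSpace X] : Prop :=
  ∃ (Y : Type u) (_ : TopologicalSpace Y) (f : X → Y), T35Space Y ∧
    Function.Bijective f ∧ ∀ K : Set X, IsCompact K → RestrictsToHomeo f K

/-- `X` is L-Tychonoff. -/
def LTychonoff (X : Type u) [TopologicalSpace X] : Prop :=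
  ∃ (Y : Type u) (_ : TopologicalSpace Y) (f : X → Y), T35Space Y ∧
    Function.Bijective f ∧ ∀ K : Set X, IsLindelof K → RestrictsToHomeo f K

theorem IsCompact.isPseudocompactSet {X : Type u} [TopologicalSpace X] {K : Set X}
    (hK : IsCompact K) : IsPseudocompactSet K := by
  intro f hf
  have : CompactSpace K := isCompact_iff_compactSpace.mp hK
  obtain ⟨M, hM⟩ := (isCompact_range hf.abs).bddAbove
  exact ⟨M, fun x => hM ⟨x, rfl⟩⟩

theorem RestrictsToHomeo.continuousOn {X : Type u} {Y : Type v} [TopologicalSpace X]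
    [TopologicalSpace Y] {f : X → Y} {K : Set X} (h : RestrictsToHomeo f K) :
    ContinuousOn f K := by
  obtain ⟨e, he⟩ := h
  rw [continuousOn_iff_continuous_domRestrict]
  exact (continuous_subtype_val.comp e.continuous).congr he

/-- A function on a sequential space that is continuous on every compact set is continuous. -/
theorem continuous_of_continuousOn_isCompact {X : Type u} {Y : Type v} [TopologicalSpace X]
    [SequentialSpace X] [TopologicalSpace Y] {f : X → Y}
    (h : ∀ K : Set X, IsCompact K → ContinuousOn f K) : Continuous f := by
  refine SeqContinuous.continuous fun x a hx => ?_
  have hc := h _ hx.isCompact_insert_range a (mem_insert a _)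
  exact hc.tendsto.comp (tendsto_nhdsWithin_iff.mpr
    ⟨hx, Eventually.of_forall fun n => mem_insert_of_mem _ (mem_range_self n)⟩)

/-- Every Ps-Tychonoff, Fréchet, Lindelöf topological space is Ps-normal. -/
theorem psNormal_of_psTychonoff_frechet_lindelof {X : Type u} [TopologicalSpace X]
    [FrechetUrysohnSpace X] [LindelofSpace X] (h : PsTychonoff X) :
    PsNormal X := by
  obtain ⟨Y, _, f, _, hbij, hf⟩ := h
  have hcont : Continuous f := continuous_of_continuousOn_isCompact fun K hK =>
    (hf K hK.isPseudocompactSet).continuousOn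
  have : LindelofSpace Y := .of_continuous_surjective hcont hbij.surjective
  exact ⟨Y, _, f, inferInstance, hbij, hf⟩
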